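/- Let p be an odd prime, G = C × H where C ≅ C₄ and H ≅ C_p × C_p, K ∈ Sup₂^min(G_r), and 𝒜 = V(K,G). Suppose that C is not an 𝒜-subgroup and that X is a basic set of 𝒜 containing an element of order 4. Then one of the following holds: (1) X is a coset of some 𝒜-subgroup L of G with |L| ∈ {p, 2p, p², 2p²}; (2) X = ⟨X⟩ \ rad(X), and in this case ⟨X⟩ = G or |rad(X)| ∈ {1, 2, p}. -/

import Mathlib

open scoped Pointwise

noncomputable section

namespace Paper

/-- The element `∑_{x ∈ X} x` of the integer group ring `ℤG`. -/
def sumElems {G : Type*} [Group G] [Finite G] (X : Set G) : MonoidAlgebra ℤ G :=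
  ∑ x ∈ X.toFinite.toFinset, MonoidAlgebra.single x (1 : ℤ)

/-- A Schur ring (S-ring) over a finite group `G`, described by the partition of `G`
into its basic sets: the partition contains `{1}`, is closed under taking inverses,
and its `ℤ`-span inside the group ring `ℤG` is closed under multiplication
(hence is a subring of `ℤG`). -/
structure SRing (G : Type*) [Group G] [Finite G] where
  basic : Set (Set G)
  nonempty : ∀ X ∈ basic, X.Nonempty
  cover : ∀ g : G, ∃! X, X ∈ basic ∧ g ∈ X
  one_mem : ({1} : Set G) ∈ basic
  inv_mem : ∀ X ∈ basic, X⁻¹ ∈ basic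
  mul_mem : ∀ a b : MonoidAlgebra ℤ G,
    a ∈ Submodule.span ℤ (sumElems '' basic) →
    b ∈ Submodule.span ℤ (sumElems '' basic) →
    a * b ∈ Submodule.span ℤ (sumElems '' basic)

namespace SRing

/-- The `ℤ`-module underlying an S-ring. -/
def span {G : Type*} [Group G] [Finite G] (A : SRing G) :
    Submodule ℤ (MonoidAlgebra ℤ G) :=
  Submodule.span ℤ (sumElems '' A.basic)

/-- A set `X ⊆ G` is an `𝒜`-set if `∑_{x ∈ X} x ∈ 𝒜`. -/
def IsASet {G : Type*} [Group G] [Finite G] (A : SRing G) (X : Set G) : Prop :=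
  sumElems X ∈ A.span

/-- A subgroup which is an `𝒜`-set is an `𝒜`-subgroup. -/
def IsASubgroup {G : Type*} [Group G] [Finite G] (A : SRing G) (H : Subgroup G) : Prop :=
  A.IsASet (H : Set G)

end SRing

/-- The arc set `R(X) = {(g, xg) : x ∈ X, g ∈ G}` of the Cayley digraph `Cay(G, X)`. -/
def Rel {G : Type*} [Group G] (X : Set G) : Set (G × G) := {p | p.2 * p.1⁻¹ ∈ X}

/-- `f : G ≃ G'` is an isomorphism from the S-ring `A` over `G` to the S-ring `B`
over `G'` if `{R(X)^f : X ∈ 𝒮(A)} = {R(Y) : Y ∈ 𝒮(B)}`. -/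
def IsSRingIso {G G' : Type*} [Group G] [Finite G] [Group G'] [Finite G']
    (A : SRing G) (B : SRing G') (f : G ≃ G') : Prop :=
  (fun X => Prod.map f f '' Rel X) '' A.basic = Rel '' B.basic

/-- The automorphism group `Aut(𝒜)` of an S-ring, as a set of permutations of `G`. -/
def SRing.autSet {G : Type*} [Group G] [Finite G] (A : SRing G) : Set (Equiv.Perm G) :=
  {f | ∀ X ∈ A.basic, Prod.map f f '' Rel X = Rel X}

/-- The set `Iso(𝒜)` of isomorphisms from `𝒜` onto S-rings over the same group `G`. -/
def SRing.isoSet {G : Type*} [Group G] [Finite G] (A : SRing G) : Set (Equiv.Perm G) :=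
  {f | ∃ B : SRing G, IsSRingIso A B f}

/-- `Aut(G)` as a set of permutations of `G`. -/
def autPerm (G : Type*) [Group G] : Set (Equiv.Perm G) :=
  Set.range fun φ : G ≃* G => (φ.toEquiv : Equiv.Perm G)

/-- A CI-S-ring: `Aut(𝒜)·Aut(G) = Iso(𝒜)`. -/
def SRing.IsCI {G : Type*} [Group G] [Finite G] (A : SRing G) : Prop :=
  A.autSet * autPerm G = A.isoSet

/-- The orbits on `G` of a set of automorphisms of `G`. -/
def setOrbits {G : Type*} [Group G] (Δ : Set (MulAut G)) : Set (Set G) :=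
  Set.range fun g : G => (fun φ : MulAut G => φ g) '' Δ

/-- An S-ring is cyclotomic if its basic sets are exactly the orbits of some
subgroup `K ≤ Aut(G)`. -/
def SRing.IsCyclotomic {G : Type*} [Group G] [Finite G] (A : SRing G) : Prop :=
  ∃ K : Subgroup (MulAut G), A.basic = setOrbits (K : Set (MulAut G))

/-- `Aut_G(𝒜) = Aut(𝒜) ∩ Aut(G)`, as a set of automorphisms of `G`. -/
def SRing.autGSet {G : Type*} [Group G] [Finite G] (A : SRing G) : Set (MulAut G) :=
  {φ | (φ.toEquiv : Equiv.Perm G) ∈ A.autSet}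

/-- A (cyclotomic) S-ring is Cayley minimal if `Aut_G(𝒜)` is the only subgroup of
`Aut(G)` whose orbits on `G` coincide with those of `Aut_G(𝒜)`. -/
def SRing.IsCayleyMinimal {G : Type*} [Group G] [Finite G] (A : SRing G) : Prop :=
  ∀ K : Subgroup (MulAut G),
    setOrbits (K : Set (MulAut G)) = setOrbits A.autGSet →
    (K : Set (MulAut G)) = A.autGSet

/-- `rad(X) = {g ∈ G : gX = Xg = X}`. -/
def rad {G : Type*} [Group G] (X : Set G) : Set G := {g | {g} * X = X ∧ X * {g} = X}

/-- The class `𝓔_c` of finite abelian groups all of whose Sylow subgroups are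
elementary abelian or isomorphic to `C₄`. -/
def InEc (G : Type*) [CommGroup G] [Finite G] : Prop :=
  ∀ p : ℕ, p.Prime → ∀ P : Sylow p G,
    (∀ x : ↥(P : Subgroup G), x ^ p = 1) ∨
    Nonempty (↥(P : Subgroup G) ≃* Multiplicative (ZMod 4))

/-- A finite group `G` is a `DCI`-group if any two Cayley digraphs over `G` that are
isomorphic as digraphs are Cayley isomorphic. -/
def IsDCIGroup (G : Type*) [Group G] : Prop :=
  ∀ S T : Set G,
    (∃ f : G ≃ G, ∀ g h : G, h * g⁻¹ ∈ S ↔ f h * (f g)⁻¹ ∈ T) →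
    ∃ φ : G ≃* G, ⇑φ '' S = T

/-- The subgroup `G_r ≤ Sym(G)` of right translations of `G`. -/
def rightTranslations (G : Type*) [Group G] : Subgroup (Equiv.Perm G) where
  carrier := Set.range fun g : G => Equiv.mulRight g
  one_mem' := ⟨1, by ext x; simp⟩
  mul_mem' := by
    rintro _ _ ⟨a, rfl⟩ ⟨b, rfl⟩
    exact ⟨b * a, by ext x; simp [mul_assoc]⟩
  inv_mem' := by
    rintro _ ⟨a, rfl⟩
    exact ⟨a⁻¹, by ext x; simp⟩

/-- The basic sets of the S-ring `V(K, G)`: the orbits of the stabilizer `K_e`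
of the identity on `G`. -/
def VBasic {G : Type*} [Group G] (K : Subgroup (Equiv.Perm G)) : Set (Set G) :=
  Set.range fun g : G => MulAction.orbit (MulAction.stabilizer K (1 : G)) g

/-- A subgroup `R ≤ Sym(G)` is regular if for all `g, h ∈ G` there is a
unique `r ∈ R` with `r(g) = h`. -/
def IsRegularSubgroup {G : Type*} [Group G] (R : Subgroup (Equiv.Perm G)) : Prop :=
  ∀ g h : G, ∃! r : R, (r : Equiv.Perm G) g = h

/-- `K ∈ Sup(G_r)`. -/
def InSup {G : Type*} [Group G] (K : Subgroup (Equiv.Perm G)) : Prop :=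
  rightTranslations G ≤ K

/-- `K ∈ Sup₂(G_r)`, i.e. `K ≥ G_r` and `K = K^{(2)} = Aut(V(K,G))`. -/
def InSup2 {G : Type*} [Group G] [Finite G] (K : Subgroup (Equiv.Perm G)) : Prop :=
  InSup K ∧
    (K : Set (Equiv.Perm G)) =
      {f : Equiv.Perm G | ∀ X ∈ VBasic K, Prod.map (⇑f) (⇑f) '' Rel X = Rel X}

/-- `K₁ ⪯_G K₂`: `K₁ ≤ K₂` and every regular subgroup of `K₂` isomorphic to `G`
is conjugate in `K₂` to a subgroup of `K₁`. -/
def GComplete {G : Type*} [Group G] (K₁ K₂ : Subgroup (Equiv.Perm G)) : Prop :=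
  K₁ ≤ K₂ ∧ ∀ R : Subgroup (Equiv.Perm G), R ≤ K₂ → IsRegularSubgroup R →
    Nonempty (↥R ≃* G) → ∃ k ∈ K₂, ∀ r ∈ R, k * r * k⁻¹ ∈ K₁

/-- `K ∈ Sup₂^min(G_r)`: a minimal element of `Sup₂(G_r)` with respect to `⪯_G`. -/
def InSup2Min {G : Type*} [Group G] [Finite G] (K : Subgroup (Equiv.Perm G)) : Prop :=
  InSup2 K ∧ ∀ K' : Subgroup (Equiv.Perm G), InSup2 K' → GComplete K' K → K' = K

/-- The basic sets of the restriction `𝒜_U` of `𝒜` to an `𝒜`-subgroup `U`: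
the basic sets of `𝒜` contained in `U`, viewed inside `U`. -/
def restrictBasic {G : Type*} [Group G] [Finite G] (A : SRing G) (U : Subgroup G) :
    Set (Set ↥U) :=
  {Y : Set ↥U | Subtype.val '' Y ∈ A.basic}

/-- The basic sets of the quotient S-ring `𝒜_{G/L}`: the images of the basic
sets of `𝒜` under the canonical epimorphism `G → G/L`. -/
def quotBasic {G : Type*} [CommGroup G] [Finite G] (A : SRing G) (L : Subgroup G) :
    Set (Set (G ⧸ L)) :=
  (fun X => QuotientGroup.mk '' X) '' A.basic

/-- The basic sets of the S-ring `𝒜_S` on the section `S = U/L`: the images under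
the canonical epimorphism `U → U/L` of the basic sets of `𝒜` contained in `U`. -/
def secBasic {G : Type*} [CommGroup G] [Finite G] (A : SRing G) (U L : Subgroup G) :
    Set (Set (↥U ⧸ L.subgroupOf U)) :=
  {Z | ∃ X ∈ A.basic, X ⊆ (U : Set G) ∧
    Z = QuotientGroup.mk '' (Subtype.val ⁻¹' X : Set ↥U)}

/-- The set of bijections of `H ⧸ N` induced by members of `Δ ⊆ Sym(H)`
permuting the `N`-cosets. -/
def inducedOnQuot {H : Type*} [CommGroup H] (N : Subgroup H) (Δ : Set (Equiv.Perm H)) :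
    Set (Equiv.Perm (H ⧸ N)) :=
  {σ | ∃ f ∈ Δ, ∀ x : H, σ (QuotientGroup.mk x) = QuotientGroup.mk (f x)}

/-- The canonical (injective) homomorphism `U/L → G/L` for `L ≤ U ≤ G`. -/
def secIncl {G : Type*} [CommGroup G] (U L : Subgroup G) :
    (↥U ⧸ L.subgroupOf U) →* G ⧸ L :=
  QuotientGroup.map (L.subgroupOf U) L U.subtype (fun _ hx => hx)

/-- The set of bijections of the section `S = U/L` induced by members of
`Δ ⊆ Sym(G/L)` preserving `S` (i.e. permuting the `L`-cosets contained in `U`). -/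
def inducedOnSec {G : Type*} [CommGroup G] (U L : Subgroup G)
    (Δ : Set (Equiv.Perm (G ⧸ L))) : Set (Equiv.Perm (↥U ⧸ L.subgroupOf U)) :=
  {σ | ∃ φ ∈ Δ, ∀ x : ↥U,
    φ (QuotientGroup.mk (x : G) : G ⧸ L) = secIncl U L (σ (QuotientGroup.mk x))}

/-- The basic sets of the S-ring `(ℤL ⊗ 𝒜_V) ≀_{(V×L)/V} ℤ(U/V)` over `U`,
where `Lu, V ≤ U` and `𝒜_V` is the restriction of `𝒜_U` to `V`. -/
def tensorWreathBasic {U : Type*} [CommGroup U] [Finite U] (AU : SRing U)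
    (Lu V : Subgroup U) : Set (Set U) :=
  {Z | (∃ l ∈ Lu, ∃ X ∈ AU.basic, X ⊆ (V : Set U) ∧ Z = l • X) ∨
       (∃ u : U, u ∉ Lu ⊔ V ∧ Z = u • (V : Set U))}

/-- Condition (CA): `𝒜_S = ℤS`. -/
def CondCA {G : Type*} [CommGroup G] [Finite G] (A : SRing G) (U L : Subgroup G) : Prop :=
  ∀ AS : SRing (↥U ⧸ L.subgroupOf U), AS.basic = secBasic A U L →
    AS.basic = Set.range fun s => ({s} : Set (↥U ⧸ L.subgroupOf U))

/-- Condition (CA'): `𝒜_U` or `𝒜_{G/L}` is cyclotomic and `𝒜_S` is Cayley minimal. -/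
def CondCA' {G : Type*} [CommGroup G] [Finite G] (A : SRing G) (U L : Subgroup G) : Prop :=
  ((∀ AU : SRing ↥U, AU.basic = restrictBasic A U → AU.IsCyclotomic) ∨
   (∀ AQ : SRing (G ⧸ L), AQ.basic = quotBasic A L → AQ.IsCyclotomic)) ∧
  (∀ AS : SRing (↥U ⧸ L.subgroupOf U), AS.basic = secBasic A U L → AS.IsCayleyMinimal)

/-- Condition (CA''): `U ≅ C_{4p}`, `L ≅ C₂` and
`𝒜_U = (ℤL ⊗ 𝒜_V) ≀_{(V×L)/V} ℤ(U/V)` for an `𝒜_U`-subgroup `V` of order `p`. -/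
def CondCA'' {G : Type*} [CommGroup G] [Finite G] (p : ℕ) (A : SRing G)
    (U L : Subgroup G) : Prop :=
  Nat.card ↥U = 4 * p ∧ IsCyclic ↥U ∧ Nat.card ↥L = 2 ∧
  ∀ AU : SRing ↥U, AU.basic = restrictBasic A U →
    ∃ V : Subgroup ↥U, AU.IsASubgroup V ∧ Nat.card ↥V = p ∧
      AU.basic = tensorWreathBasic AU (L.subgroupOf U) V

/-- `𝒜 = 𝒜_{G₁} ⊗ 𝒜_{G₂}` for `G = G₁ × G₂` (internally). -/
def IsTensorDecomp {G : Type*} [CommGroup G] [Finite G] (A : SRing G)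
    (G₁ G₂ : Subgroup G) : Prop :=
  A.IsASubgroup G₁ ∧ A.IsASubgroup G₂ ∧ G₁ ⊓ G₂ = ⊥ ∧ G₁ ⊔ G₂ = ⊤ ∧
  A.basic = {Z | ∃ X ∈ A.basic, ∃ Y ∈ A.basic,
    X ⊆ (G₁ : Set G) ∧ Y ⊆ (G₂ : Set G) ∧ Z = X * Y}

/-- `𝒜` is the tensor product of two S-rings over proper nontrivial subgroups of `G`. -/
def TensorConclusion {G : Type*} [CommGroup G] [Finite G] (A : SRing G) : Prop :=
  ∃ G₁ G₂ : Subgroup G, G₁ ≠ ⊥ ∧ G₁ ≠ ⊤ ∧ G₂ ≠ ⊥ ∧ G₂ ≠ ⊤ ∧ IsTensorDecomp A G₁ G₂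

/-- `𝒜` is a nontrivial `S = U/L`-wreath product satisfying one of the
conditions (CA), (CA'), (CA''). -/
def WreathConclusion {G : Type*} [CommGroup G] [Finite G] (p : ℕ) (A : SRing G) : Prop :=
  ∃ U L : Subgroup G, L ≤ U ∧ A.IsASubgroup U ∧ A.IsASubgroup L ∧ L ≠ ⊥ ∧ U ≠ ⊤ ∧
    (∀ X ∈ A.basic, ¬ X ⊆ (U : Set G) → (L : Set G) ⊆ rad X) ∧
    (CondCA A U L ∨ CondCA' A U L ∨ CondCA'' p A U L)


section SchurRelation

variable {G : Type*}

/-- Membership of `S` is constant along the relation `r`. -/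
def IsRSet (r : G → G → Prop) (S : Set G) : Prop := ∀ x y, r x y → (x ∈ S ↔ y ∈ S)

theorem IsRSet.union {r : G → G → Prop} {S T : Set G} (hS : IsRSet r S) (hT : IsRSet r T) :
    IsRSet r (S ∪ T) := fun x y h => by
  simp only [Set.mem_union, hS x y h, hT x y h]

theorem IsRSet.compl {r : G → G → Prop} {S : Set G} (hS : IsRSet r S) : IsRSet r Sᶜ :=
  fun x y h => not_congr (hS x y h)

variable [CommGroup G]

/-- The coefficients of `a` are constant along the relation `r`. -/
def RInv (r : G → G → Prop) (a : MonoidAlgebra ℤ G) : Prop :=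
  ∀ x y, r x y → a.coeff x = a.coeff y

/-- The elements of `ℤG` with coefficients constant along `r` form an S-ring. -/
structure IsSchurRel (r : G → G → Prop) : Prop where
  one : ∀ x y, r x y → (x = 1 ↔ y = 1)
  inv : ∀ x y, r x y → r x⁻¹ y⁻¹
  mul : ∀ a b : MonoidAlgebra ℤ G, RInv r a → RInv r b → RInv r (a * b)

/-- `X` is a nonempty union of `r`-classes contained in every one it meets. -/
structure IsRBasic (r : G → G → Prop) (X : Set G) : Prop where
  isRSet : IsRSet r X
  subset : ∀ S, IsRSet r S → ∀ x ∈ X, x ∈ S → X ⊆ S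

theorem coeff_mul_eq_sum [Fintype G] {k : Type*} [Semiring k] (a b : MonoidAlgebra k G) (x : G) :
    (a * b).coeff x = ∑ y, a.coeff y * b.coeff (y⁻¹ * x) := by
  classical
  rw [MonoidAlgebra.coeff_mul, Finsupp.sum_fintype _ _ (by simp)]
  refine Finset.sum_congr rfl fun y _ => ?_
  rw [Finsupp.sum_fintype _ _ (by simp)]
  simp only [← eq_inv_mul_iff_mul_eq]
  simp

namespace IsRSet

variable {r : G → G → Prop} {S : Set G}

theorem one (hr : IsSchurRel r) : IsRSet r ({1} : Set G) := fun x y h => by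
  simpa using hr.one x y h

theorem inv (hr : IsSchurRel r) (hS : IsRSet r S) : IsRSet r S⁻¹ := fun x y h => by
  simpa using hS _ _ (hr.inv x y h)

end IsRSet

variable [Finite G]

theorem sumElems_eq_sum [Fintype G] (S : Set G) [DecidablePred (· ∈ S)] :
    sumElems S = ∑ x with x ∈ S, MonoidAlgebra.single x (1 : ℤ) := by
  unfold sumElems
  congr 1
  ext
  simp

theorem sumElems_coeff (S : Set G) [DecidablePred (· ∈ S)] (x : G) :
    (sumElems S).coeff x = if x ∈ S then 1 else 0 := by
  classical
  simp [sumElems, MonoidAlgebra.coeff_sum, Finsupp.single_apply]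

theorem rInv_sumElems {r : G → G → Prop} {S : Set G} :
    RInv r (sumElems S) ↔ IsRSet r S := by
  classical
  refine forall₃_congr fun x y _ => ?_
  rw [sumElems_coeff, sumElems_coeff]
  by_cases hx : x ∈ S <;> by_cases hy : y ∈ S <;> simp [hx, hy]

namespace IsRSet

variable {r : G → G → Prop} {S T : Set G}

theorem ncard_eq (hr : IsSchurRel r) (hS : IsRSet r S) (hT : IsRSet r T) {x y : G} (h : r x y) :
    {s | s ∈ S ∧ s⁻¹ * x ∈ T}.ncard = {s | s ∈ S ∧ s⁻¹ * y ∈ T}.ncard := by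
  classical
  have := Fintype.ofFinite G
  have key := hr.mul _ _ (rInv_sumElems.2 hS) (rInv_sumElems.2 hT) x y h
  have hc : ∀ x : G, (sumElems S * sumElems T).coeff x =
      ({s | s ∈ S ∧ s⁻¹ * x ∈ T}.ncard : ℤ) := by
    intro x
    rw [coeff_mul_eq_sum, Set.ncard_eq_toFinset_card', Finset.card_eq_sum_ones,
      Set.toFinset_ofPred, Finset.sum_filter]
    push_cast
    refine Finset.sum_congr rfl fun y _ => ?_
    rw [sumElems_coeff, sumElems_coeff]
    by_cases h1 : y ∈ S <;> by_cases h2 : y⁻¹ * x ∈ T <;> simp [h1, h2]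
  rw [hc, hc] at key
  exact_mod_cast key

theorem mul (hr : IsSchurRel r) (hS : IsRSet r S) (hT : IsRSet r T) : IsRSet r (S * T) := by
  intro x y h
  have hc : ∀ x : G, x ∈ S * T ↔ {s | s ∈ S ∧ s⁻¹ * x ∈ T}.ncard ≠ 0 := by
    intro x
    rw [ne_eq, Set.ncard_eq_zero (Set.toFinite _), ← ne_eq, ← Set.nonempty_iff_ne_empty]
    constructor
    · rintro ⟨s, hs, t, ht, rfl⟩
      exact ⟨s, hs, by simpa using ht⟩
    · rintro ⟨s, hs, ht⟩
      exact ⟨s, hs, _, ht, by simp⟩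
  rw [hc, hc, hS.ncard_eq hr hT h]

theorem stabilizer (hr : IsSchurRel r) (hS : IsRSet r S) :
    IsRSet r (MulAction.stabilizer G S : Set G) := by
  intro x y h
  have hc : ∀ x : G, x ∈ MulAction.stabilizer G S ↔
      {s | s ∈ S ∧ s⁻¹ * x ∈ S⁻¹}.ncard = S.ncard := by
    intro x
    rw [← inv_mem_iff, MulAction.mem_stabilizer_iff]
    have h1 : {s | s ∈ S ∧ s⁻¹ * x ∈ S⁻¹} ⊆ S := fun s hs => hs.1
    have h2 : ∀ s, s⁻¹ * x ∈ S⁻¹ ↔ x⁻¹ * s ∈ S := by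
      intro s
      simp
    constructor
    · intro hx
      congr 1
      refine h1.antisymm fun s hs => ⟨hs, (h2 s).2 ?_⟩
      rw [← hx]
      exact Set.smul_mem_smul_set hs
    · intro hx
      have h3 := Set.eq_of_subset_of_ncard_le h1 hx.ge (Set.toFinite _)
      refine Set.eq_of_subset_of_ncard_le ?_ (Set.ncard_smul_set _ _).ge (Set.toFinite _)
      rintro _ ⟨s, hs, rfl⟩
      rw [← h3] at hs
      exact (h2 s).1 hs.2
  exact (hc x).trans ((Eq.congr_left (hS.ncard_eq hr (hS.inv hr) h)).trans (hc y).symm)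

theorem pow (hr : IsSchurRel r) (hS : IsRSet r S) (k : ℕ) : IsRSet r (S ^ k) := by
  induction k with
  | zero => exact IsRSet.one hr
  | succ k ih => rw [pow_succ]; exact ih.mul hr hS

theorem closure (hr : IsSchurRel r) (hS : IsRSet r S) :
    IsRSet r (Subgroup.closure S : Set G) := by
  have hc : ∀ x : G, x ∈ Subgroup.closure S ↔ ∃ k : ℕ, x ∈ S ^ k := by
    intro x
    constructor
    · intro hx
      rw [← Subgroup.mem_toSubmonoid, Subgroup.closure_toSubmonoid_of_finite] at hx
      induction hx using Submonoid.closure_induction with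
      | mem x hx => exact ⟨1, by simpa using hx⟩
      | one => exact ⟨0, by simp⟩
      | mul x y _ _ hx hy =>
        obtain ⟨k, hk⟩ := hx
        obtain ⟨l, hl⟩ := hy
        exact ⟨k + l, by rw [pow_add]; exact Set.mul_mem_mul hk hl⟩
    · rintro ⟨k, hk⟩
      induction k generalizing x with
      | zero =>
        obtain rfl : x = 1 := by simpa using hk
        exact one_mem _
      | succ k ih =>
        rw [pow_succ] at hk
        obtain ⟨a, ha, b, hb, rfl⟩ := hk
        exact mul_mem (ih a ha) (Subgroup.subset_closure hb)
  intro x y h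
  exact (hc x).trans ((exists_congr fun k => hS.pow hr k x y h).trans (hc y).symm)

theorem natCast_ncard_pow_eq (hr : IsSchurRel r) (hS : IsRSet r S) {q : ℕ} (hq : q.Prime)
    {x y : G} (h : r x y) :
    ({s | s ∈ S ∧ s ^ q = x}.ncard : ZMod q) = ({s | s ∈ S ∧ s ^ q = y}.ncard : ZMod q) := by
  classical
  have := Fintype.ofFinite G
  have := Fact.mk hq
  have hpow : ∀ k : ℕ, RInv r (sumElems S ^ k) := by
    intro k
    induction k with
    | zero =>
      have : (1 : MonoidAlgebra ℤ G) = sumElems {1} := by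
        ext x
        simp [sumElems_coeff, MonoidAlgebra.one_def, Finsupp.single_apply, eq_comm]
      rw [pow_zero, this]
      exact rInv_sumElems.2 (IsRSet.one hr)
    | succ k ih =>
      rw [pow_succ]
      exact hr.mul _ _ ih (rInv_sumElems.2 hS)
  have : CharP (MonoidAlgebra (ZMod q) G) q :=
    charP_of_injective_algebraMap (algebraMap (ZMod q) (MonoidAlgebra (ZMod q) G)).injective q
  have hc : ∀ x : G, ((sumElems S ^ q).coeff x : ZMod q) = {s | s ∈ S ∧ s ^ q = x}.ncard := by
    intro x
    have h1 := MonoidAlgebra.coeff_mapRingHom (M := G) (Int.castRingHom (ZMod q)) (sumElems S ^ q) x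
    rw [eq_intCast] at h1
    rw [← h1, map_pow, sumElems_eq_sum, map_sum]
    simp only [MonoidAlgebra.mapRingHom_single, map_one]
    rw [sum_pow_char, Set.ncard_eq_toFinset_card', Finset.card_eq_sum_ones,
      Set.toFinset_ofPred, ← Finset.filter_filter, Finset.sum_filter (fun s => s ^ q = x)]
    push_cast
    rw [MonoidAlgebra.coeff_sum, Finsupp.finsetSum_apply]
    refine Finset.sum_congr rfl fun s _ => ?_
    rw [MonoidAlgebra.single_pow, one_pow, MonoidAlgebra.coeff_single, Finsupp.single_apply]
  rw [← hc, ← hc, hpow q x y h]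

theorem image_pow (hr : IsSchurRel r) {m : ℕ} (hm : Function.Injective fun g : G => g ^ m)
    (hS : IsRSet r S) : IsRSet r ((fun g => g ^ m) '' S) := by
  induction m using induction_on_primes generalizing S with
  | zero =>
    have : Subsingleton G := ⟨fun a b => hm (by simp)⟩
    intro x y _
    rw [Subsingleton.elim x y]
  | one => simpa using hS
  | prime_mul q a hq ih =>
    have hqi : Function.Injective fun g : G => g ^ q := by
      intro g h hgh
      apply hm
      simp only [pow_mul] at hgh ⊢
      rw [hgh]
    have hai : Function.Injective fun g : G => g ^ a := by
      intro g h hgh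
      apply hm
      simp only [pow_mul'] at hgh ⊢
      rw [hgh]
    have hSq : IsRSet r ((fun g => g ^ q) '' S) := by
      have hc : ∀ x, x ∈ (fun g => g ^ q) '' S ↔
          ({s | s ∈ S ∧ s ^ q = x}.ncard : ZMod q) ≠ 0 := by
        intro x
        constructor
        · rintro ⟨s, hs, rfl⟩
          have : {t | t ∈ S ∧ t ^ q = s ^ q} = {s} := by
            ext t
            exact ⟨fun ht => hqi ht.2, by rintro rfl; exact ⟨hs, rfl⟩⟩
          have hq' := Fact.mk hq
          simp [this]
        · intro hx
          by_contra hn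
          apply hx
          have : {s | s ∈ S ∧ s ^ q = x} = ∅ := by
            ext t
            simp only [Set.mem_ofPred_eq, Set.mem_empty_iff_false, iff_false]
            exact fun ht => hn ⟨t, ht.1, ht.2⟩
          simp [this]
      intro x y h
      rw [hc, hc, hS.natCast_ncard_pow_eq hr hq h]
    have := ih hai hSq
    simpa only [Set.image_image, ← pow_mul] using this

theorem image_sq (hr : IsSchurRel r) {z : G} (hz : ∀ g : G, g ^ 2 = 1 ↔ g = 1 ∨ g = z)
    (hz1 : z ≠ 1) (hS : IsRSet r S) : IsRSet r {x | ∃ s ∈ S, z * s ∉ S ∧ s ^ 2 = x} := by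
  have hzz : z ^ 2 = 1 := (hz z).2 (Or.inr rfl)
  have hsq : ∀ s t : G, t ^ 2 = s ^ 2 ↔ t = s ∨ t = z * s := by
    intro s t
    rw [← div_eq_one, ← div_pow, hz, div_eq_one, div_eq_iff_eq_mul]
  have hc : ∀ x, x ∈ {x | ∃ s ∈ S, z * s ∉ S ∧ s ^ 2 = x} ↔
      ({s | s ∈ S ∧ s ^ 2 = x}.ncard : ZMod 2) = 1 := by
    intro x
    constructor
    · rintro ⟨s, hs, hzs, rfl⟩
      have : {t | t ∈ S ∧ t ^ 2 = s ^ 2} = {s} := by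
        ext t
        simp only [hsq, Set.mem_ofPred_eq, Set.mem_singleton_iff]
        constructor
        · rintro ⟨h, rfl | rfl⟩
          · rfl
          · exact absurd h hzs
        · rintro rfl
          exact ⟨hs, Or.inl rfl⟩
      simp [this]
    · intro hx
      by_contra hn
      simp only [Set.mem_ofPred_eq, not_exists, not_and] at hn
      by_cases hne : ∃ s ∈ S, s ^ 2 = x
      · obtain ⟨s, hs, rfl⟩ := hne
        have hzs : z * s ∈ S := by
          by_contra h
          exact hn s hs h rfl
        have : {t | t ∈ S ∧ t ^ 2 = s ^ 2} = {s, z * s} := by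
          ext t
          simp only [hsq, Set.mem_ofPred_eq, Set.mem_insert_iff, Set.mem_singleton_iff]
          constructor
          · exact fun h => h.2
          · rintro (rfl | rfl)
            · exact ⟨hs, Or.inl rfl⟩
            · exact ⟨hzs, Or.inr rfl⟩
        rw [this, Set.ncard_pair (by simpa using hz1)] at hx
        exact absurd hx (by decide)
      · have : {s | s ∈ S ∧ s ^ 2 = x} = ∅ := by
          ext t
          simp only [Set.mem_ofPred_eq, Set.mem_empty_iff_false, iff_false]
          exact fun ht => hne ⟨t, ht.1, ht.2⟩
        simp [this] at hx
  intro x y h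
  rw [hc, hc, hS.natCast_ncard_pow_eq hr Nat.prime_two h]

theorem image_two_mul (hr : IsSchurRel r) {z : G} (hz : ∀ g : G, g ^ 2 = 1 ↔ g = 1 ∨ g = z)
    (hz1 : z ≠ 1) {m : ℕ} (hm : Function.Injective fun g : G => g ^ m) (hS : IsRSet r S) :
    IsRSet r {x | ∃ s ∈ S, z * s ∉ S ∧ s ^ (2 * m) = x} := by
  convert (hS.image_sq hr hz hz1).image_pow hr hm using 1
  ext x
  simp [pow_mul, and_assoc]

end IsRSet

section Quotient

variable (R : Subgroup G) {r : G → G → Prop}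

/-- The relation induced by `r` on the quotient by `R`. -/
def quotRel (R : Subgroup G) (r : G → G → Prop) (u v : G ⧸ R) : Prop :=
  ∃ x y, r x y ∧ (x : G ⧸ R) = u ∧ (y : G ⧸ R) = v

theorem sum_quotient_mk [Fintype G] [Fintype (G ⧸ R)] (f : G ⧸ R → ℤ) :
    ∑ x : G, f x = Nat.card R * ∑ u, f u := by
  classical
  have := Fintype.ofFinite R
  rw [Fintype.sum_equiv Subgroup.groupEquivQuotientProdSubgroup (fun x : G => f x)
    (fun p : (G ⧸ R) × R => f p.1) (fun x => rfl), Fintype.sum_prod_type]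
  simp [Finset.mul_sum]

theorem IsSchurRel.quotRel (hr : IsSchurRel r) (hR : IsRSet r (R : Set G)) :
    IsSchurRel (quotRel R r) where
  one := by
    rintro _ _ ⟨x, y, h, rfl, rfl⟩
    simpa [QuotientGroup.eq_one_iff] using hR x y h
  inv := by
    rintro _ _ ⟨x, y, h, rfl, rfl⟩
    exact ⟨_, _, hr.inv x y h, rfl, rfl⟩
  mul := by
    classical
    have := Fintype.ofFinite G
    rintro a b ha hb _ _ ⟨x, y, h, rfl, rfl⟩
    let lift (a : MonoidAlgebra ℤ (G ⧸ R)) : MonoidAlgebra ℤ G :=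
      .ofCoeff (Finsupp.equivFunOnFinite.symm fun x => a.coeff (x : G ⧸ R))
    have hl : ∀ a x, (lift a).coeff x = a.coeff (x : G ⧸ R) := fun a x => rfl
    have hinv : ∀ a, RInv (Paper.quotRel R r) a → RInv r (lift a) := fun a ha x y h =>
      ha _ _ ⟨x, y, h, rfl, rfl⟩
    have hmul : ∀ x, (lift a * lift b).coeff x = Nat.card R * (a * b).coeff (x : G ⧸ R) := by
      intro x
      rw [coeff_mul_eq_sum, coeff_mul_eq_sum, ← sum_quotient_mk]
      rfl
    have key := hr.mul _ _ (hinv a ha) (hinv b hb) x y h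
    rw [hmul, hmul] at key
    exact mul_left_cancel₀ (by exact_mod_cast Nat.card_pos.ne') key

omit [Finite G] in
theorem IsRBasic.quotRel {X : Set G} (hX : IsRBasic r X)
    (hR : R ≤ MulAction.stabilizer G X) :
    IsRBasic (quotRel R r) ((↑) '' X : Set (G ⧸ R)) ∧
      ∀ x : G, (x : G ⧸ R) ∈ ((↑) '' X : Set (G ⧸ R)) ↔ x ∈ X := by
  have hmem : ∀ x : G, (x : G ⧸ R) ∈ ((↑) '' X : Set (G ⧸ R)) ↔ x ∈ X := by
    intro x
    refine ⟨?_, fun h => ⟨x, h, rfl⟩⟩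
    rintro ⟨y, hy, hyx⟩
    have h1 := MulAction.mem_stabilizer_set.1 (hR (QuotientGroup.eq.1 hyx)) y
    rw [smul_eq_mul, mul_right_comm, inv_mul_cancel, one_mul] at h1
    exact h1.2 hy
  refine ⟨⟨?_, ?_⟩, hmem⟩
  · rintro _ _ ⟨x, y, h, rfl, rfl⟩
    rw [hmem, hmem]
    exact hX.isRSet x y h
  · rintro S hS _ ⟨x, hx, rfl⟩ hxS
    rw [Set.image_subset_iff]
    exact hX.subset _ (fun x y h => hS _ _ ⟨x, y, h, rfl, rfl⟩) x hx hxS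

end Quotient

omit [Finite G] in
theorem eq_one_of_pow_eq_one_of_coprime {a b : ℕ} (hab : a.Coprime b) {d : G} (ha : d ^ a = 1)
    (hb : d ^ b = 1) : d = 1 :=
  orderOf_eq_one_iff.1 (Nat.eq_one_of_dvd_coprimes hab (orderOf_dvd_of_pow_eq_one ha)
    (orderOf_dvd_of_pow_eq_one hb))

omit [Finite G] in
theorem pow_injective_of_coprime {m N : ℕ} (hm : m.Coprime N) (hN : ∀ g : G, g ^ N = 1) :
    Function.Injective fun g : G => g ^ m := fun g h hgh =>
  div_eq_one.1 <| eq_one_of_pow_eq_one_of_coprime hm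
    (by rw [div_pow, div_eq_one]; exact hgh) (hN _)

variable {r : G → G → Prop} {X T : Set G} {z : G} {n : ℕ}

theorem exists_eq_closure_diff (hr : IsSchurRel r) (hX : IsRBasic r X) (hT : IsRSet r T)
    (hTX : ∀ x ∈ X, x ∉ Subgroup.closure T) (hz : z ^ 2 = 1) (hzX : z ∈ Subgroup.closure X)
    (hXT : ∀ x ∈ X, z * x ∉ X → z * x ∈ T) (hT' : ∀ t ∈ T, z * t ∈ X)
    (hZ : ∀ Z : Subgroup G, IsRSet r (Z : Set G) → z ∈ Z → ∃ x ∈ X, x ∈ Z) :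
    ∃ D ≤ Subgroup.closure X, X = (Subgroup.closure X : Set G) \ D := by
  have hstab : ∀ b ∈ X ∪ T, z * b ∈ X ∪ T := by
    rintro b (hb | hb)
    · by_cases h : z * b ∈ X
      · exact Or.inl h
      · exact Or.inr (hXT b hb h)
    · exact Or.inl (hT' b hb)
  have hzs : z ∈ MulAction.stabilizer G (X ∪ T) := by
    refine MulAction.mem_stabilizer_set.2 fun b => ⟨fun h => ?_, hstab b⟩
    have := hstab _ h
    rwa [smul_eq_mul, ← mul_assoc, ← sq, hz, one_mul] at this
  have hs := (hX.isRSet.union hT).stabilizer hr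
  obtain ⟨x, hxX, hxZ⟩ := hZ _ hs hzs
  have hle : Subgroup.closure X ≤ MulAction.stabilizer G (X ∪ T) :=
    (Subgroup.closure_le _).2 (hX.subset _ hs x hxX hxZ)
  have hTU : T ⊆ Subgroup.closure X := fun t ht => by
    simpa using mul_mem (inv_mem hzX) (Subgroup.subset_closure (hT' t ht))
  refine ⟨Subgroup.closure T, (Subgroup.closure_le _).2 hTU, ?_⟩
  refine Set.Subset.antisymm (fun x hx => ⟨Subgroup.subset_closure hx, hTX x hx⟩) ?_
  rintro u ⟨hu, huT⟩
  have h1 : u * x⁻¹ ∈ MulAction.stabilizer G (X ∪ T) :=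
    hle (mul_mem hu (inv_mem (Subgroup.subset_closure hxX)))
  have h2 := (MulAction.mem_stabilizer_set.1 h1 x).2 (Or.inl hxX)
  rw [smul_eq_mul, inv_mul_cancel_right] at h2
  exact h2.resolve_right fun h => huT (Subgroup.subset_closure h)

omit [Finite G] in
theorem IsRBasic.notMem_subgroup (hX : IsRBasic r X) {Z : Subgroup G} (hZ : IsRSet r (Z : Set G))
    {c : G} (hcX : c ∈ X) (hcZ : c ∉ Z) : ∀ x ∈ X, x ∉ Z :=
  fun x hx hxZ => hcZ (hX.subset _ hZ x hx hxZ hcX)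

theorem exists_two_mul_eq (hn : Odd n) :
    ∃ m, 2 * m = n * n + 1 ∧ m.Coprime (4 * n) := by
  obtain ⟨k, rfl⟩ := hn
  refine ⟨2 * k * k + 2 * k + 1, by ring, ?_⟩
  refine Nat.Coprime.mul_right ?_ ?_
  · have : (2 * k * k + 2 * k + 1).Coprime (2 ^ 2) :=
      Nat.Coprime.pow_right 2 (Nat.coprime_two_right.2 ⟨k * k + k, by ring⟩)
    exact this
  · have h : ((2 * k + 1) * (2 * k + 1) + 1).Coprime (2 * k + 1) := by
      simp
    refine Nat.Coprime.coprime_dvd_left ⟨2, by ring⟩ h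

omit [Finite G] in
theorem pow_mul_self_add_one {d : G} (hd : d ^ n = 1) : d ^ (n * n + 1) = d := by
  rw [pow_succ, pow_mul, hd, one_pow, one_mul]

theorem exists_eq_closure_diff_of_involution (hr : IsSchurRel r) (hn : Odd n) (hz1 : z ≠ 1)
    (hz2 : z ^ 2 = 1) (hG : ∀ g : G, ∃ d, d ^ n = 1 ∧ (g = d ∨ g = z * d))
    (hX : IsRBasic r X) (hzX : z ∈ X) :
    ∃ D ≤ Subgroup.closure X, X = (Subgroup.closure X : Set G) \ D := by
  obtain ⟨m, hm, hmc⟩ := exists_two_mul_eq hn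
  have hzn : z ^ n = z := by
    obtain ⟨k, rfl⟩ := hn
    rw [pow_succ, pow_mul, hz2, one_pow, one_mul]
  have hN : ∀ g : G, g ^ (4 * n) = 1 := by
    intro g
    obtain ⟨d, hd, rfl | rfl⟩ := hG g
    · rw [pow_mul', hd, one_pow]
    · rw [mul_pow, pow_mul', pow_mul' d, hd, hzn, pow_mul z 2 2, hz2, one_pow, one_pow, one_mul]
  have hz : ∀ g : G, g ^ 2 = 1 ↔ g = 1 ∨ g = z := by
    intro g
    refine ⟨fun hg => ?_, by rintro (rfl | rfl) <;> simp [hz2]⟩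
    obtain ⟨d, hd, rfl | rfl⟩ := hG g
    · exact Or.inl (eq_one_of_pow_eq_one_of_coprime (Nat.coprime_two_left.2 hn) hg hd)
    · rw [mul_pow, hz2, one_mul] at hg
      rw [eq_one_of_pow_eq_one_of_coprime (Nat.coprime_two_left.2 hn) hg hd]
      simp
  have hT := hX.isRSet.image_two_mul hr hz hz1 (pow_injective_of_coprime hmc hN)
  rw [hm] at hT
  have hzz : z ^ (n * n + 1) = 1 := by rw [← hm, pow_mul, hz2, one_pow]
  set T := {x | ∃ s ∈ X, z * s ∉ X ∧ s ^ (n * n + 1) = x} with hTdef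
  have hTn : Subgroup.closure T ≤ (powMonoidHom n : G →* G).ker := by
    rw [Subgroup.closure_le]
    rintro _ ⟨s, -, -, rfl⟩
    rw [SetLike.mem_coe, MonoidHom.mem_ker, powMonoidHom_apply]
    obtain ⟨d, hd, rfl | rfl⟩ := hG s
    · rw [pow_mul_self_add_one hd, hd]
    · rw [mul_pow, pow_mul_self_add_one hd, hzz, one_mul, hd]
  have hTX : ∀ x ∈ X, x ∉ Subgroup.closure T :=
    hX.notMem_subgroup (hT.closure hr) hzX fun h => hz1 (hzn ▸ hTn h)
  refine exists_eq_closure_diff hr hX hT hTX hz2 (Subgroup.subset_closure hzX) ?_ ?_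
    fun Z _ h => ⟨z, hzX, h⟩
  · intro x hx hzx
    have hxT : x ^ (n * n + 1) ∈ T := ⟨x, hx, hzx, rfl⟩
    obtain ⟨d, hd, rfl | rfl⟩ := hG x
    · rw [pow_mul_self_add_one hd] at hxT
      exact absurd (Subgroup.subset_closure hxT) (hTX _ hx)
    · rw [mul_pow, hzz, one_mul, pow_mul_self_add_one hd] at hxT
      rwa [← mul_assoc, ← sq, hz2, one_mul]
  · rintro _ ⟨x, hx, hzx, rfl⟩
    have hxT : x ^ (n * n + 1) ∈ T := ⟨x, hx, hzx, rfl⟩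
    obtain ⟨d, hd, rfl | rfl⟩ := hG x
    · rw [pow_mul_self_add_one hd] at hxT
      exact absurd (Subgroup.subset_closure hxT) (hTX _ hx)
    · rwa [mul_pow, hzz, one_mul, pow_mul_self_add_one hd]

theorem exists_eq_closure_diff_of_sq_mem_stabilizer (hr : IsSchurRel r) (hn : Odd n) {c : G}
    (hc2 : c ^ 2 ≠ 1)
    (hG : ∀ g : G, ∃ d, d ^ n = 1 ∧ (g = d ∨ g = c * d ∨ g = c ^ 2 * d ∨ g = c ^ 3 * d))
    (hX : IsRBasic r X) (hcX : c ∈ X) (hs : c ^ 2 ∈ MulAction.stabilizer G X) :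
    ∃ D ≤ Subgroup.closure X, X = (Subgroup.closure X : Set G) \ D := by
  set R := MulAction.stabilizer G X with hR
  have hRr : IsRSet r (R : Set G) := hX.isRSet.stabilizer hr
  have hcR : c ∉ R := by
    intro h
    have h1 : (1 : G) ∈ X := (MulAction.mem_stabilizer_set.1 h 1).1 (by simpa using hcX)
    have h2 : c = 1 := by simpa using hX.subset _ (IsRSet.one hr) 1 h1 rfl hcX
    exact hc2 (by rw [h2, one_pow])
  have hRX : R ≤ Subgroup.closure X := fun g hg => by
    have h1 : g * c ∈ X := (MulAction.mem_stabilizer_set.1 hg c).2 hcX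
    simpa using mul_mem (Subgroup.subset_closure h1) (inv_mem (Subgroup.subset_closure hcX))
  obtain ⟨hX', hmem⟩ := hX.quotRel R le_rfl
  have hc2' : (c : G ⧸ R) ^ 2 = 1 := by
    rw [← QuotientGroup.mk_pow, QuotientGroup.eq_one_iff]
    exact hs
  obtain ⟨D, hD, hXD⟩ := exists_eq_closure_diff_of_involution (hr.quotRel R hRr) hn
    (z := (c : G ⧸ R)) (by rwa [ne_eq, QuotientGroup.eq_one_iff]) hc2'
    (by
      intro g
      obtain ⟨g, rfl⟩ := QuotientGroup.mk_surjective g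
      obtain ⟨d, hd, h⟩ := hG g
      refine ⟨(d : G ⧸ R), by rw [← QuotientGroup.mk_pow, hd, QuotientGroup.mk_one], ?_⟩
      rcases h with rfl | rfl | rfl | rfl
      · exact Or.inl rfl
      · exact Or.inr rfl
      · left
        rw [QuotientGroup.mk_mul, QuotientGroup.mk_pow, hc2', one_mul]
      · right
        rw [QuotientGroup.mk_mul, QuotientGroup.mk_pow, pow_succ, hc2', one_mul])
    hX' ((hmem c).2 hcX)
  have hcl : ∀ g : G, (g : G ⧸ R) ∈ Subgroup.closure ((↑) '' X : Set (G ⧸ R)) ↔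
      g ∈ Subgroup.closure X := by
    intro g
    have h1 := MonoidHom.map_closure (QuotientGroup.mk' R) X
    rw [QuotientGroup.coe_mk'] at h1
    rw [← h1, Subgroup.mem_map]
    refine ⟨?_, fun hg => ⟨g, hg, rfl⟩⟩
    rintro ⟨x, hx, hxg⟩
    have h2 := hRX (QuotientGroup.eq.1 hxg)
    simpa using mul_mem hx h2
  refine ⟨D.comap (QuotientGroup.mk' R), fun g hg => (hcl g).1 (hD hg), ?_⟩
  ext g
  rw [← hmem, hXD]
  exact and_congr (hcl g) Iff.rfl

theorem coset_or_exists_eq_closure_diff (hr : IsSchurRel r) (hn : Odd n) {c : G}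
    (hc4 : c ^ 4 = 1) (hc2 : c ^ 2 ≠ 1)
    (hG : ∀ g : G, ∃ d, d ^ n = 1 ∧ (g = d ∨ g = c * d ∨ g = c ^ 2 * d ∨ g = c ^ 3 * d))
    (hX : IsRBasic r X) (hcX : c ∈ X) :
    (∃ D : Subgroup G, IsRSet r (D : Set G) ∧ (∀ d ∈ D, d ^ n = 1) ∧ X = c • (D : Set G)) ∨
      ∃ D ≤ Subgroup.closure X, X = (Subgroup.closure X : Set G) \ D := by
  by_cases hs : c ^ 2 ∈ MulAction.stabilizer G X
  · exact Or.inr (exists_eq_closure_diff_of_sq_mem_stabilizer hr hn hc2 hG hX hcX hs)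
  obtain ⟨m, hm, hmc⟩ := exists_two_mul_eq hn
  have hc : ∀ a b : ℕ, a % 4 = b % 4 → c ^ a = c ^ b := fun a b h => by
    rw [pow_eq_pow_mod a hc4, h, ← pow_eq_pow_mod b hc4]
  have hz2 : (c ^ 2) ^ 2 = 1 := by rw [← pow_mul, hc4]
  have hnn : n * n % 4 = 1 ∧ 2 * n % 4 = 2 := by
    obtain ⟨k, rfl⟩ := hn
    refine ⟨?_, by lia⟩
    rw [show (2 * k + 1) * (2 * k + 1) = 4 * (k * k + k) + 1 by ring]
    lia
  have hpow : ∀ (i a : ℕ) (d : G), (c ^ i * d) ^ a = c ^ (i * a) * d ^ a := fun i a d => by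
    rw [mul_pow, pow_mul]
  have hzn : ∀ d : G, d ^ n = 1 → (c ^ 2 * d) ^ n = c ^ 2 := fun d hd => by
    rw [hpow, hd, mul_one]
    exact hc _ _ (by lia)
  have hG' : ∀ g : G, ∃ d, d ^ n = 1 ∧ (g = c ^ 0 * d ∨ g = c ^ 1 * d ∨ g = c ^ 2 * d ∨
      g = c ^ 3 * d) := by simpa using hG
  have hN : ∀ g : G, g ^ (4 * n) = 1 := by
    intro g
    obtain ⟨d, hd, h⟩ := hG' g
    obtain ⟨i, rfl⟩ : ∃ i, g = c ^ i * d := by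
      rcases h with h | h | h | h <;> exact ⟨_, h⟩
    rw [hpow, pow_mul' d, hd, one_pow, mul_one, mul_left_comm, pow_mul, hc4, one_pow]
  have hz : ∀ g : G, g ^ 2 = 1 ↔ g = 1 ∨ g = c ^ 2 := by
    intro g
    refine ⟨fun hg => ?_, by rintro (rfl | rfl) <;> simp [hz2]⟩
    have hd1 : ∀ d : G, d ^ n = 1 → d ^ 2 = 1 → d = 1 := fun d hd h2 =>
      eq_one_of_pow_eq_one_of_coprime (Nat.coprime_two_left.2 hn) h2 hd
    have hodd : ∀ d : G, d ^ n = 1 → c ^ 2 * d ^ 2 ≠ 1 := fun d hd h => by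
      have h1 := hzn (d ^ 2) (by rw [pow_right_comm, hd, one_pow])
      rw [h, one_pow] at h1
      exact hc2 h1.symm
    obtain ⟨d, hd, rfl | rfl | rfl | rfl⟩ := hG' g
    · rw [pow_zero, one_mul] at hg ⊢
      exact Or.inl (hd1 d hd hg)
    · rw [hpow] at hg
      exact absurd hg (hodd d hd)
    · rw [mul_pow, hz2, one_mul] at hg
      rw [hd1 d hd hg, mul_one]
      exact Or.inr rfl
    · rw [hpow, hc (3 * 2) 2 rfl] at hg
      exact absurd hg (hodd d hd)
  have hφ : ∀ (i j : ℕ) (d : G), d ^ n = 1 → (2 * i) % 4 = j % 4 →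
      (c ^ i * d) ^ (n * n + 1) = c ^ j * d := fun i j d hd h => by
    rw [hpow, pow_mul_self_add_one hd, hc (i * (n * n + 1)) j]
    rw [Nat.mul_mod, Nat.add_mod, hnn.1, ← h, mul_comm 2 i]
    simp [Nat.mul_mod]
  have hσ : ∀ (i j : ℕ) (d : G), d ^ n = 1 → (3 * i) % 4 = j % 4 →
      (c ^ i * d) ^ (2 * n + 1) = c ^ j * d := fun i j d hd h => by
    rw [hpow, pow_succ d, pow_mul' d, hd, one_pow, one_mul, hc (i * (2 * n + 1)) j]
    rw [Nat.mul_mod, Nat.add_mod, hnn.2, ← h, mul_comm 3 i]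
    simp [Nat.mul_mod]
  have hχ : ∀ (i j : ℕ) (d : G), d ^ n = 1 → (2 * i) % 4 = j % 4 →
      (c ^ i * d) ^ (2 * n) = c ^ j := fun i j d hd h => by
    rw [hpow, pow_mul' d, hd, one_pow, mul_one, hc (i * (2 * n)) j]
    rw [Nat.mul_mod, hnn.2, ← h, mul_comm 2 i]
    simp [Nat.mul_mod]
  have hinj := pow_injective_of_coprime hmc hN
  have himage : ∀ S, IsRSet r S → IsRSet r {x | ∃ s ∈ S, c ^ 2 * s ∉ S ∧ s ^ (n * n + 1) = x} := by
    intro S hS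
    rw [← hm]
    exact hS.image_two_mul hr hz hc2 hinj
  have hT := himage X hX.isRSet
  set T := {x | ∃ s ∈ X, c ^ 2 * s ∉ X ∧ s ^ (n * n + 1) = x} with hTdef
  have hTn : Subgroup.closure T ≤ (powMonoidHom (2 * n) : G →* G).ker := by
    rw [Subgroup.closure_le]
    rintro _ ⟨s, -, -, rfl⟩
    rw [SetLike.mem_coe, MonoidHom.mem_ker, powMonoidHom_apply, ← pow_mul, ← hm,
      show 2 * m * (2 * n) = 4 * n * m by ring, pow_mul, hN, one_pow]
  have hcT : c ∉ Subgroup.closure T := fun h => by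
    have h1 : c ^ (2 * n) = 1 := hTn h
    have h2 := hc (2 * n) 2 hnn.2
    exact hc2 (h2 ▸ h1)
  have hTX : ∀ x ∈ X, x ∉ Subgroup.closure T :=
    hX.notMem_subgroup (hT.closure hr) hcX hcT
  have hz0 : ∀ i j (d : G), (i + 2) % 4 = j % 4 → c ^ 2 * (c ^ i * d) = c ^ j * d := by
    intro i j d h
    rw [← mul_assoc, ← pow_add, hc (2 + i) j (by lia)]
  by_cases hZ : ∀ Z : Subgroup G, IsRSet r (Z : Set G) → c ^ 2 ∈ Z → c ∈ Z
  · right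
    have hzT : ∀ d : G, d ^ n = 1 → c ^ 2 * d ∉ T := fun d hd h => hcT <|
      hZ _ (hT.closure hr) (hzn d hd ▸ pow_mem (Subgroup.subset_closure h) n)
    refine exists_eq_closure_diff hr hX hT hTX hz2 (pow_mem (Subgroup.subset_closure hcX) 2) ?_ ?_
      fun Z hZr h => ⟨c, hcX, hZ Z hZr h⟩
    · intro x hx hzx
      have hxT : x ^ (n * n + 1) ∈ T := ⟨x, hx, hzx, rfl⟩
      obtain ⟨d, hd, rfl | rfl | rfl | rfl⟩ := hG' x
      · rw [hφ 0 0 d hd rfl] at hxT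
        exact absurd (Subgroup.subset_closure hxT) (hTX _ hx)
      · rw [hφ 1 2 d hd rfl] at hxT
        exact absurd hxT (hzT d hd)
      · rw [hφ 2 0 d hd rfl] at hxT
        rwa [hz0 2 0 d rfl]
      · rw [hφ 3 2 d hd rfl] at hxT
        exact absurd hxT (hzT d hd)
    · rintro _ ⟨x, hx, hzx, rfl⟩
      have hxT : x ^ (n * n + 1) ∈ T := ⟨x, hx, hzx, rfl⟩
      obtain ⟨d, hd, rfl | rfl | rfl | rfl⟩ := hG' x
      · rw [hφ 0 0 d hd rfl] at hxT
        exact absurd (Subgroup.subset_closure hxT) (hTX _ hx)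
      · rw [hφ 1 2 d hd rfl] at hxT
        exact absurd hxT (hzT d hd)
      · rwa [hφ 2 0 d hd rfl, hz0 0 2 d rfl]
      · rw [hφ 3 2 d hd rfl] at hxT
        exact absurd hxT (hzT d hd)
  left
  push Not at hZ
  obtain ⟨Z, hZr, hzZ, hcZ⟩ := hZ
  have hσc : (2 * n + 1).Coprime (4 * n) := by
    refine Nat.Coprime.mul_right ?_ ?_
    · exact Nat.Coprime.pow_right 2 (Nat.coprime_two_right.2 ⟨n, rfl⟩)
    · simp
  have hσX := hX.isRSet.image_pow hr (pow_injective_of_coprime hσc hN)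
  have hσeq : ∀ x ∈ X, x ^ (2 * n + 1) ∈ X → ∀ y ∈ X, y ^ (2 * n + 1) ∈ X := by
    intro x hx hxσ y hy
    have h1 := hX.subset _ hσX _ hxσ ⟨x, hx, rfl⟩
    have h2 := Set.eq_of_subset_of_ncard_le h1 (Set.ncard_image_le (Set.toFinite _))
      (Set.toFinite _)
    rw [h2]
    exact ⟨y, hy, rfl⟩
  have hnot : ¬ ∀ x ∈ X, c ^ 2 * x ∈ X := fun h => hs <|
    MulAction.mem_stabilizer_set.2 fun b => ⟨fun hb => by
      simpa [← mul_assoc, ← pow_add, hc4] using h _ hb, h b⟩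
  have hX2 : ∀ x ∈ X, ∃ d, d ^ n = 1 ∧ (x = c ^ 1 * d ∨ x = c ^ 3 * d) := by
    by_contra! hcon
    obtain ⟨x₀, hx₀, hx₀'⟩ := hcon
    have hfix : x₀ ^ (2 * n + 1) = x₀ := by
      obtain ⟨d, hd, rfl | rfl | rfl | rfl⟩ := hG' x₀
      · exact hσ 0 0 d hd rfl
      · exact absurd rfl (hx₀' d hd).1
      · exact hσ 2 2 d hd rfl
      · exact absurd rfl (hx₀' d hd).2
    have hall := hσeq x₀ hx₀ (hfix.symm ▸ hx₀)
    have hZn : ∀ g ∈ Z, g ^ (2 * n) = 1 := by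
      intro g hg
      obtain ⟨d, hd, rfl | rfl | rfl | rfl⟩ := hG' g
      · exact (hχ 0 0 d hd rfl).trans (pow_zero c)
      · refine absurd ?_ hcZ
        have := pow_mem hg (n * n)
        rwa [hpow, pow_mul d, hd, one_pow, mul_one, hc (1 * (n * n)) 1 (by lia), pow_one] at this
      · exact (hχ 2 4 d hd rfl).trans hc4
      · refine absurd ?_ hcZ
        have := mul_mem hzZ (pow_mem hg (n * n))
        rwa [hpow, pow_mul d, hd, one_pow, mul_one, hc (3 * (n * n)) 3 (by lia), ← pow_add,
          hc (2 + 3) 1 rfl, pow_one] at this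
    refine hnot fun x hx => ?_
    by_contra hzx
    have hxT : x ^ (n * n + 1) ∈ T := ⟨x, hx, hzx, rfl⟩
    have hx' := hall x hx
    obtain ⟨d, hd, rfl | rfl | rfl | rfl⟩ := hG' x
    · rw [hφ 0 0 d hd rfl] at hxT
      exact hTX _ hx (Subgroup.subset_closure hxT)
    · rw [hσ 1 3 d hd rfl] at hx'
      exact hzx (by rwa [hz0 1 3 d rfl])
    · rw [hφ 2 0 d hd rfl, pow_zero, one_mul] at hxT
      have hmul : IsRSet r ((Z : Set G) * (Subgroup.closure T : Set G)) :=
        hZr.mul hr (hT.closure hr)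
      obtain ⟨a, ha, b, hb, hab⟩ := hX.subset _ hmul _ hx
        (Set.mul_mem_mul hzZ (Subgroup.subset_closure hxT)) hcX
      have h1 : c ^ (2 * n) = 1 := by
        rw [← hab]
        simp only [mul_pow]
        rw [hZn a ha, one_mul]
        exact hTn hb
      have h2 := hc (2 * n) 2 hnn.2
      exact hc2 (h2 ▸ h1)
    · rw [hσ 3 1 d hd rfl] at hx'
      exact hzx (by rwa [hz0 3 1 d rfl])
  have hσz : ∀ x ∈ X, x ^ (2 * n + 1) = c ^ 2 * x := by
    intro x hx
    obtain ⟨d, hd, rfl | rfl⟩ := hX2 x hx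
    · rw [hσ 1 3 d hd rfl, hz0 1 3 d rfl]
    · rw [hσ 3 1 d hd rfl, hz0 3 1 d rfl]
  have hzX : ∀ x ∈ X, c ^ 2 * x ∉ X := fun x hx hzx => hnot fun y hy => by
    rw [← hσz y hy]
    exact hσeq x hx (by rwa [hσz x hx]) y hy
  have hdn : ∀ (d e : G), d ^ n = 1 → e ^ n = 1 → c ^ 2 * d ≠ e := by
    intro d e hd he h
    have := hzn d hd
    rw [h, he] at this
    exact hc2 this.symm
  have hTz : ∀ t ∈ T, ∃ d, d ^ n = 1 ∧ (c ^ 1 * d ∈ X ∨ c ^ 3 * d ∈ X) ∧ t = c ^ 2 * d := by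
    rintro _ ⟨s, hsX, -, rfl⟩
    obtain ⟨d, hd, rfl | rfl⟩ := hX2 s hsX
    · exact ⟨d, hd, Or.inl hsX, hφ 1 2 d hd rfl⟩
    · exact ⟨d, hd, Or.inr hsX, hφ 3 2 d hd rfl⟩
  set D₀ := {d : G | d ^ n = 1 ∧ c ^ 1 * d ∈ X} with hD₀
  set D₁ := {d : G | d ^ n = 1 ∧ c ^ 3 * d ∈ X} with hD₁
  have hDr : IsRSet r (D₀ ∪ D₁) := by
    convert himage T hT using 1
    ext x
    constructor
    · have key : ∀ i, (2 * i) % 4 = 2 → x ^ n = 1 → c ^ i * x ∈ X →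
          ∃ t ∈ T, c ^ 2 * t ∉ T ∧ t ^ (n * n + 1) = x := by
        intro i hi hxn hx
        have hxT : c ^ 2 * x ∈ T := ⟨_, hx, hzX _ hx, hφ i 2 x hxn hi⟩
        refine ⟨_, hxT, fun h => ?_, by rw [hφ 2 0 x hxn rfl, pow_zero, one_mul]⟩
        obtain ⟨d, hd, -, hd'⟩ := hTz _ h
        rw [hz0 2 0 x rfl, pow_zero, one_mul] at hd'
        exact hdn d x hd hxn hd'.symm
      rintro (⟨hxn, hx⟩ | ⟨hxn, hx⟩)
      · exact key 1 rfl hxn hx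
      · exact key 3 rfl hxn hx
    · rintro ⟨t, ht, -, rfl⟩
      obtain ⟨d, hd, hdX, rfl⟩ := hTz t ht
      rw [hφ 2 0 d hd rfl, pow_zero, one_mul]
      exact hdX.imp (fun h => ⟨hd, h⟩) fun h => ⟨hd, h⟩
  have hDn : ∀ d ∈ D₀ ∪ D₁, d ^ n = 1 := fun d hd => hd.elim And.left And.left
  set S := X ∪ (fun g => g ^ (2 * n + 1)) '' X with hS
  have hSr : IsRSet r S := hX.isRSet.union hσX
  have hSD : ∀ d : G, d ^ n = 1 → ((c ^ 1 * d ∈ S ↔ d ∈ D₀ ∪ D₁) ∧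
      (c ^ 3 * d ∈ S ↔ d ∈ D₀ ∪ D₁)) := by
    intro d hd
    have h1 : ∀ x, x ∈ (fun g => g ^ (2 * n + 1)) '' X ↔ c ^ 2 * x ∈ X := by
      intro x
      constructor
      · rintro ⟨y, hy, rfl⟩
        simp only [hσz y hy]
        rwa [← mul_assoc, ← sq, hz2, one_mul]
      · intro hx
        refine ⟨_, hx, ?_⟩
        simp only [hσz _ hx]
        rw [← mul_assoc, ← sq, hz2, one_mul]
    constructor
    · rw [hS, Set.mem_union, h1, hz0 1 3 d rfl]
      exact or_congr (by simp [hD₀, hd]) (by simp [hD₁, hd])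
    · rw [hS, Set.mem_union, h1, hz0 3 1 d rfl, or_comm]
      exact or_congr (by simp [hD₀, hd]) (by simp [hD₁, hd])
  have hmulS : ∀ x ∈ X, ∀ d ∈ D₀ ∪ D₁, x * d ∈ S := by
    have hV : IsRSet r (Sᶜ * (D₀ ∪ D₁)⁻¹)ᶜ := (hSr.compl.mul hr (hDr.inv hr)).compl
    have hcV : c ∈ (Sᶜ * (D₀ ∪ D₁)⁻¹)ᶜ := by
      rintro ⟨s, hsS, d, hd, hsd⟩
      apply hsS
      have : s = c ^ 1 * d⁻¹ := by
        rw [pow_one, eq_mul_inv_iff_mul_eq]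
        exact hsd
      rw [this]
      exact (hSD _ (hDn _ hd)).1.2 hd
    intro x hx d hd
    by_contra hxd
    exact hX.subset _ hV c hcX hcV hx ⟨x * d, hxd, d⁻¹, by simpa using hd, by simp⟩
  have hDmul : ∀ {g h : G}, g ∈ D₀ ∪ D₁ → h ∈ D₀ ∪ D₁ → g * h ∈ D₀ ∪ D₁ := by
    intro g h hg hh
    have hgh : (g * h) ^ n = 1 := by rw [mul_pow, hDn g hg, hDn h hh, one_mul]
    rcases hg with ⟨_, hg⟩ | ⟨_, hg⟩
    · refine (hSD _ hgh).1.1 ?_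
      rw [← mul_assoc]
      exact hmulS _ hg h hh
    · refine (hSD _ hgh).2.1 ?_
      rw [← mul_assoc]
      exact hmulS _ hg h hh
  let M : Submonoid G :=
    { carrier := D₀ ∪ D₁
      mul_mem' := hDmul
      one_mem' := Or.inl ⟨one_pow n, by simpa using hcX⟩ }
  let D : Subgroup G :=
    { M with
      inv_mem' := by
        intro g hg
        have h1 : g⁻¹ = g ^ (n - 1) := by
          rw [inv_eq_iff_mul_eq_one, ← pow_succ', Nat.sub_add_cancel hn.pos]
          exact hDn g hg
        rw [h1]
        exact M.pow_mem hg _ }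
  have hD : (D : Set G) = D₀ ∪ D₁ := rfl
  have hdisj : Disjoint D₀ D₁ := by
    rw [Set.disjoint_left]
    rintro d ⟨hd, h1⟩ ⟨_, h3⟩
    exact hzX _ h1 (by rwa [hz0 1 3 d rfl])
  have hcount : ∀ i, i = 1 ∨ i = 3 → ∀ g ∈ D,
      {s | s ∈ X ∧ s⁻¹ * (c ^ i * g) ∈ (D : Set G)} = c ^ i • {d | d ^ n = 1 ∧ c ^ i * d ∈ X} := by
    intro i hi g hg
    ext s
    rw [Set.mem_smul_set_iff_inv_smul_mem]
    simp only [smul_eq_mul, Set.mem_ofPred_eq, SetLike.mem_coe, mul_inv_cancel_left]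
    constructor
    · rintro ⟨hsX, hsD⟩
      refine ⟨?_, hsX⟩
      have h1 : (c ^ i)⁻¹ * s = (s⁻¹ * (c ^ i * g) * g⁻¹)⁻¹ := by
        rw [← mul_assoc, mul_inv_cancel_right, mul_inv, inv_inv, mul_comm]
      rw [h1]
      exact hDn _ (inv_mem (mul_mem hsD (inv_mem hg)))
    · rintro ⟨hsn, hsX⟩
      refine ⟨hsX, ?_⟩
      have h1 : s⁻¹ * (c ^ i * g) = ((c ^ i)⁻¹ * s)⁻¹ * g := by
        rw [mul_inv, inv_inv, ← mul_assoc, mul_comm s⁻¹]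
      rw [h1]
      refine mul_mem (inv_mem ?_) hg
      rcases hi with rfl | rfl
      · exact Or.inl ⟨hsn, by simpa using hsX⟩
      · exact Or.inr ⟨hsn, by simpa using hsX⟩
  have hD₁e : D₁ = ∅ := by
    by_contra hne
    obtain ⟨g, hg, hgX⟩ := Set.nonempty_iff_ne_empty.2 hne
    have hgD : g ∈ D := Or.inr ⟨hg, hgX⟩
    have hDr' : IsRSet r (D : Set G) := hDr
    have hlevel : IsRSet r {y | {s | s ∈ X ∧ s⁻¹ * y ∈ (D : Set G)}.ncard =
        {s | s ∈ X ∧ s⁻¹ * (c ^ 1 * 1) ∈ (D : Set G)}.ncard} := fun x y h => by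
      simp only [Set.mem_ofPred_eq]
      rw [hX.isRSet.ncard_eq hr hDr' h]
    have h1 : c ^ 3 * g ∈ _ := hX.subset _ hlevel c hcX (by simp) hgX
    rw [Set.mem_ofPred_eq, hcount 3 (Or.inr rfl) g hgD, hcount 1 (Or.inl rfl) 1 (one_mem D),
      Set.ncard_smul_set, Set.ncard_smul_set] at h1
    have hcard : Nat.card D = 2 * D₀.ncard := by
      have h2 : Nat.card D = (D₀ ∪ D₁).ncard := rfl
      rw [h2, Set.ncard_union_eq hdisj (Set.toFinite _) (Set.toFinite _), two_mul]
      exact congrArg _ h1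
    have := Fact.mk Nat.prime_two
    obtain ⟨x, hx⟩ := exists_prime_orderOf_dvd_card' (G := D) 2 ⟨_, hcard⟩
    have hx2 : x ^ 2 = 1 := hx ▸ pow_orderOf_eq_one x
    have hxn : x ^ n = 1 := Subtype.ext (by simpa using hDn _ x.2)
    have hx1 : x = 1 :=
      eq_one_of_pow_eq_one_of_coprime (Nat.coprime_two_left.2 hn) hx2 hxn
    rw [hx1, orderOf_one] at hx
    exact absurd hx (by decide)
  refine ⟨D, hDr, hDn, ?_⟩
  ext x
  rw [Set.mem_smul_set_iff_inv_smul_mem, hD, hD₁e, Set.union_empty, smul_eq_mul]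
  constructor
  · intro hx
    obtain ⟨d, hd, rfl | rfl⟩ := hX2 x hx
    · rw [pow_one, inv_mul_cancel_left]
      exact ⟨hd, hx⟩
    · have : d ∈ D₁ := ⟨hd, hx⟩
      rw [hD₁e] at this
      exact absurd this (Set.notMem_empty d)
  · rintro ⟨_, hx⟩
    simpa using hx

end SchurRelation

section SRingRel

variable {G : Type*} [CommGroup G] [Finite G]

/-- Two elements are related if they lie in a common basic set. -/
def SRing.rel (A : SRing G) (x y : G) : Prop := ∃ Z ∈ A.basic, x ∈ Z ∧ y ∈ Z

namespace SRing

variable (A : SRing G) {X Y : Set G}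

theorem eq_of_mem_basic (hX : X ∈ A.basic) (hY : Y ∈ A.basic) {x : G} (hxX : x ∈ X)
    (hxY : x ∈ Y) : X = Y :=
  (A.cover x).unique ⟨hX, hxX⟩ ⟨hY, hxY⟩

theorem isRSet_of_mem_basic (hX : X ∈ A.basic) : IsRSet A.rel X := by
  rintro x y ⟨Z, hZ, hx, hy⟩
  constructor
  · intro h
    rwa [A.eq_of_mem_basic hX hZ h hx]
  · intro h
    rwa [A.eq_of_mem_basic hX hZ h hy]

theorem isRBasic_of_mem_basic (hX : X ∈ A.basic) : IsRBasic A.rel X where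
  isRSet := A.isRSet_of_mem_basic hX
  subset _ hS x hx hxS y hy := (hS x y ⟨X, hX, hx, hy⟩).1 hxS

theorem mem_span_iff_rInv (a : MonoidAlgebra ℤ G) : a ∈ A.span ↔ RInv A.rel a := by
  classical
  constructor
  · intro ha
    induction ha using Submodule.span_induction with
    | mem a ha =>
      obtain ⟨Z, hZ, rfl⟩ := ha
      exact rInv_sumElems.2 (A.isRSet_of_mem_basic hZ)
    | zero => exact fun x y _ => rfl
    | add a b _ _ iha ihb =>
      intro x y h
      simp [iha x y h, ihb x y h]
    | smul k a _ ih =>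
      intro x y h
      rw [MonoidAlgebra.coeff_smul, Finsupp.smul_apply, Finsupp.smul_apply, ih x y h]
  · intro ha
    have key : a = ∑ Z ∈ A.basic.toFinite.toFinset,
        (if h : Z.Nonempty then a.coeff h.some else 0) • sumElems Z := by
      ext x
      obtain ⟨Z, ⟨hZ, hxZ⟩, -⟩ := A.cover x
      rw [MonoidAlgebra.coeff_sum, Finsupp.finsetSum_apply, Finset.sum_eq_single Z]
      · have hne : Z.Nonempty := ⟨x, hxZ⟩
        simp only [hne, dif_pos, MonoidAlgebra.coeff_smul, Finsupp.smul_apply,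
          sumElems_coeff, hxZ, if_pos, smul_eq_mul, mul_one]
        exact ha _ _ ⟨Z, hZ, hxZ, hne.some_mem⟩
      · intro Y hY hYZ
        have hxY : x ∉ Y := fun h =>
          hYZ (A.eq_of_mem_basic (by simpa using hY) hZ h hxZ)
        rw [MonoidAlgebra.coeff_smul, Finsupp.smul_apply, sumElems_coeff, if_neg hxY, smul_zero]
      · intro h
        exact absurd (by simpa using hZ) h
    rw [key]
    refine Submodule.sum_mem _ fun Z hZ => Submodule.smul_mem _ _ (Submodule.subset_span ?_)
    exact ⟨Z, by simpa using hZ, rfl⟩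

theorem isASet_iff_isRSet : A.IsASet X ↔ IsRSet A.rel X :=
  (A.mem_span_iff_rInv _).trans rInv_sumElems

theorem isSchurRel_rel : IsSchurRel A.rel where
  one x y h := A.isRSet_of_mem_basic A.one_mem x y h
  inv := by
    rintro x y ⟨Z, hZ, hx, hy⟩
    exact ⟨Z⁻¹, A.inv_mem Z hZ, by simpa, by simpa⟩
  mul a b ha hb := by
    rw [← mem_span_iff_rInv] at ha hb ⊢
    exact A.mul_mem a b ha hb

end SRing

omit [Finite G] in
theorem rad_eq_stabilizer (X : Set G) : rad X = (MulAction.stabilizer G X : Set G) := by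
  ext g
  rw [SetLike.mem_coe, MulAction.mem_stabilizer_iff]
  change {g} * X = X ∧ X * {g} = X ↔ g • X = X
  rw [mul_comm X, and_self, Set.singleton_mul]
  rfl

omit [Finite G] in
theorem rad_eq_of_eq_closure_diff {X : Set G} (hne : X.Nonempty) {D : Subgroup G}
    (hD : D ≤ Subgroup.closure X) (hX : X = (Subgroup.closure X : Set G) \ D) :
    rad X = (D : Set G) := by
  rw [rad_eq_stabilizer]
  have hDX : ∀ g, g ∈ X ↔ g ∈ Subgroup.closure X ∧ g ∉ D := fun g => by
    conv_lhs => rw [hX]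
    rfl
  ext g
  rw [SetLike.mem_coe, SetLike.mem_coe, MulAction.mem_stabilizer_iff]
  constructor
  · intro hg
    obtain ⟨x, hx⟩ := hne
    have hgx : g * x ∈ X := by
      rw [← hg]
      exact Set.smul_mem_smul_set hx
    by_contra hgD
    have hgU : g ∈ Subgroup.closure X :=
      (Subgroup.mul_mem_cancel_right _ ((hDX x).1 hx).1).1 ((hDX _).1 hgx).1
    have h1 : g⁻¹ * g ∈ X := by
      have : g ∈ g • X := by
        rw [hg]
        exact (hDX g).2 ⟨hgU, hgD⟩
      exact Set.mem_smul_set_iff_inv_smul_mem.1 this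
    exact ((hDX _).1 h1).2 (by simp)
  · intro hg
    ext x
    rw [Set.mem_smul_set_iff_inv_smul_mem, hDX, hDX, smul_eq_mul,
      Subgroup.mul_mem_cancel_left _ (inv_mem (hD hg)),
      Subgroup.mul_mem_cancel_left _ (inv_mem hg)]

omit [Finite G] in
theorem mem_of_four_dvd_card {p : ℕ} (hodd : Odd p) (hG : Nat.card G = 4 * p ^ 2) {c : G}
    (hc : c ^ 4 = 1) {D : Subgroup G} (hD : 4 ∣ Nat.card D) : c ∈ D := by
  obtain ⟨m, hm⟩ := hD
  have hi : D.index ∣ p ^ 2 := by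
    have := D.card_mul_index
    rw [hG, hm, mul_assoc] at this
    exact ⟨m, by rw [mul_comm]; exact (Nat.eq_of_mul_eq_mul_left (by norm_num) this).symm⟩
  obtain ⟨l, hl⟩ := hi
  obtain ⟨k, rfl⟩ := hodd
  have h1 : c ^ (2 * k + 1) ^ 2 = c := by
    rw [show (2 * k + 1) ^ 2 = 4 * (k ^ 2 + k) + 1 by ring, pow_succ, pow_mul, hc, one_pow, one_mul]
  rw [← h1, hl, pow_mul]
  exact pow_mem (D.pow_index_mem c) l

end SRingRel

/-- In the setting of the classification over `C₄ × C_p × C_p`,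
suppose `C` is not an `𝒜`-subgroup and `X` is a basic set of `𝒜` containing an
element of order `4`. Then `X` is a coset of an `𝒜`-subgroup `L` with
`|L| ∈ {p, 2p, p², 2p²}`, or `X = ⟨X⟩ \ rad(X)` with `⟨X⟩ = G` or
`|rad(X)| ∈ {1, 2, p}`. -/
theorem stmt15 (p : ℕ) (hp : p.Prime) (hodd : Odd p)
    (G : Type*) [CommGroup G] [Finite G] (C H : Subgroup G)
    (hC : Nonempty (↥C ≃* Multiplicative (ZMod 4)))
    (hH : Nonempty (↥H ≃* Multiplicative (ZMod p) × Multiplicative (ZMod p)))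
    (hinf : C ⊓ H = ⊥) (hsup : C ⊔ H = ⊤)
    (K : Subgroup (Equiv.Perm G)) (hK : InSup2Min K)
    (A : SRing G) (hA : A.basic = VBasic K)
    (hCA : ¬ A.IsASubgroup C)
    (X : Set G) (hX : X ∈ A.basic) (hx4 : ∃ x ∈ X, orderOf x = 4) :
    (∃ L : Subgroup G, A.IsASubgroup L ∧
      Nat.card ↥L ∈ ({p, 2 * p, p ^ 2, 2 * p ^ 2} : Set ℕ) ∧
      ∃ g : G, X = g • (L : Set G)) ∨
    (X = (Subgroup.closure X : Set G) \ rad X ∧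
      (Subgroup.closure X = ⊤ ∨ (rad X).ncard ∈ ({1, 2, p} : Set ℕ))) := by
  have hCcard : Nat.card C = 4 := by simp [Nat.card_congr hC.some.toEquiv]
  have hHcard : Nat.card H = p ^ 2 := by
    rw [Nat.card_congr hH.some.toEquiv, Nat.card_prod, sq]
    simp [Nat.card_congr (Multiplicative.toAdd (α := ZMod p))]
  have hHp : ∀ h ∈ H, h ^ p = 1 := by
    intro h hh
    have h1 : (⟨h, hh⟩ : H) ^ p = 1 := by
      apply hH.some.injective
      rw [map_pow, map_one]
      ext
      · exact Multiplicative.toAdd.injective (by simp)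
      · exact Multiplicative.toAdd.injective (by simp)
    exact congrArg Subtype.val h1
  have hGcard : Nat.card G = 4 * p ^ 2 := by
    rw [← hCcard, ← hHcard]
    refine (Subgroup.IsComplement'.card_mul_card ?_).symm
    refine Subgroup.isComplement'_of_disjoint_and_mul_eq_univ (disjoint_iff.2 hinf) ?_
    rw [← Subgroup.mul_normal, hsup, Subgroup.coe_top]
  have hcop : Nat.Coprime p 4 := hodd.coprime_two_right.pow_right 2
  obtain ⟨c, hcX, hc4⟩ := hx4
  have hmul : ∀ g : G, ∃ a ∈ C, ∃ h ∈ H, a * h = g := fun g =>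
    Subgroup.mem_sup.1 (hsup ▸ Subgroup.mem_top g)
  have hcC : c ∈ C := by
    obtain ⟨a, ha, h, hh, rfl⟩ := hmul c
    have h4 : (a * h) ^ 4 = 1 := hc4 ▸ pow_orderOf_eq_one _
    have ha4 : a ^ 4 = 1 := by
      have := pow_card_eq_one' (x := (⟨a, ha⟩ : C))
      rw [hCcard] at this
      exact congrArg Subtype.val this
    rw [mul_pow, ha4, one_mul] at h4
    rwa [eq_one_of_pow_eq_one_of_coprime hcop (hHp h hh) h4, mul_one]
  have hCz : Subgroup.zpowers c = C := by
    refine Subgroup.eq_of_le_of_card_ge ((Subgroup.zpowers_le).2 hcC) ?_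
    rw [Nat.card_zpowers, hc4, hCcard]
  have hc41 : c ^ 4 = 1 := hc4 ▸ pow_orderOf_eq_one c
  have hc21 : c ^ 2 ≠ 1 := fun h => by
    have := orderOf_dvd_of_pow_eq_one h
    rw [hc4] at this
    exact absurd this (by decide)
  have hG : ∀ g : G, ∃ d, d ^ p = 1 ∧ (g = d ∨ g = c * d ∨ g = c ^ 2 * d ∨ g = c ^ 3 * d) := by
    intro g
    obtain ⟨a, ha, h, hh, rfl⟩ := hmul g
    refine ⟨h, hHp h hh, ?_⟩
    classical
    rw [← hCz, mem_zpowers_iff_mem_range_orderOf, hc4] at ha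
    obtain ⟨i, hi, rfl⟩ := Finset.mem_image.1 ha
    rw [Finset.mem_range] at hi
    interval_cases i <;> simp
  have hr := A.isSchurRel_rel
  have hXb := A.isRBasic_of_mem_basic hX
  have hUA : IsRSet A.rel (Subgroup.closure X : Set G) := hXb.isRSet.closure hr
  have hUC : Subgroup.closure X ≠ C := fun h => hCA (A.isASet_iff_isRSet.2 (h ▸ hUA))
  rcases coset_or_exists_eq_closure_diff hr hodd hc41 hc21 hG hXb hcX with
    ⟨D, hD, hDp, hXD⟩ | ⟨D, hDU, hXD⟩
  · left
    refine ⟨D, A.isASet_iff_isRSet.2 hD, ?_, c, hXD⟩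
    have := Fact.mk hp
    have hDP : IsPGroup p D := fun d => ⟨1, by
      rw [pow_one]
      exact Subtype.ext (hDp d d.2)⟩
    obtain ⟨k, hk⟩ := IsPGroup.iff_card.1 hDP
    have hdvd : p ^ k ∣ p ^ 2 := by
      refine (Nat.Coprime.pow_left k hcop).dvd_of_dvd_mul_left ?_
      rw [← hk, ← hGcard]
      exact D.card_subgroup_dvd_card
    have hk2 : k ≤ 2 := (Nat.pow_dvd_pow_iff_le_right hp.one_lt).1 hdvd
    rw [hk]
    interval_cases k
    · refine absurd ?_ hUC
      rw [pow_zero, Subgroup.card_eq_one] at hk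
      rw [hXD, hk, ← hCz, Subgroup.zpowers_eq_closure]
      simp
    · simp
    · simp
  · have hDrad := rad_eq_of_eq_closure_diff ⟨c, hcX⟩ hDU hXD
    have hDX : ∀ g, g ∈ X ↔ g ∈ Subgroup.closure X ∧ g ∉ D := fun g => by
      conv_lhs => rw [hXD]
      rfl
    have hcU := ((hDX c).1 hcX).1
    have hcD := ((hDX c).1 hcX).2
    have h4U : 4 ∣ Nat.card (Subgroup.closure X) := by
      rw [← hc4, ← Subgroup.orderOf_mk c hcU]
      exact orderOf_dvd_natCard _
    have h4D : ¬ 4 ∣ Nat.card D := fun h => hcD (mem_of_four_dvd_card hodd hGcard hc41 h)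
    obtain ⟨m, hm⟩ := h4U
    have hmp : m ∣ p ^ 2 := by
      have := (Subgroup.closure X).card_subgroup_dvd_card
      rw [hm, hGcard] at this
      exact Nat.dvd_of_mul_dvd_mul_left (by norm_num) this
    have hXrad : X = (Subgroup.closure X : Set G) \ rad X := by rwa [hDrad]
    obtain ⟨k, hk2, rfl⟩ := (Nat.dvd_prime_pow hp).1 hmp
    interval_cases k
    · refine absurd ?_ hUC
      rw [← hCz]
      refine (Subgroup.eq_of_le_of_card_ge (Subgroup.zpowers_le.2 hcU) ?_).symm
      rw [Nat.card_zpowers, hc4, hm, pow_zero, mul_one]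
    · rw [pow_one] at hm
      have hDdvd : Nat.card D ∣ 4 * p := hm ▸ Subgroup.card_dvd_of_le hDU
      obtain ⟨a, b, ha, hb, hab⟩ := Nat.dvd_mul.1 hDdvd
      have hncard : (rad X).ncard = Nat.card D := by
        rw [hDrad]
        exact Nat.card_coe_set_eq _
      have ha' : a = 1 ∨ a = 2 := by
        have : a ≤ 4 := Nat.le_of_dvd (by norm_num) ha
        interval_cases a
        · simp at ha
        · simp
        · simp
        · omega
        · exact absurd ⟨b, hab.symm⟩ h4D
      rcases ha' with rfl | rfl <;> rcases (Nat.dvd_prime hp).1 hb with rfl | rfl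
      · exact Or.inr ⟨hXrad, Or.inr (by simp [hncard, ← hab])⟩
      · exact Or.inr ⟨hXrad, Or.inr (by simp [hncard, ← hab])⟩
      · exact Or.inr ⟨hXrad, Or.inr (by simp [hncard, ← hab])⟩
      · left
        refine ⟨D, A.isASet_iff_isRSet.2 ?_, by simp [← hab], c, ?_⟩
        · rw [← hDrad, rad_eq_stabilizer]
          exact hXb.isRSet.stabilizer hr
        · refine (Set.eq_of_subset_of_ncard_le ?_ ?_ (Set.toFinite _)).symm
          · rintro _ ⟨d, hd, rfl⟩
            refine (hDX _).2 ⟨mul_mem hcU (hDU hd), fun h => hcD ?_⟩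
            exact (Subgroup.mul_mem_cancel_right _ hd).1 h
          · have h1 : (D : Set G).ncard = 2 * b := (Nat.card_coe_set_eq _).trans hab.symm
            have h2 : (Subgroup.closure X : Set G).ncard = 4 * b := (Nat.card_coe_set_eq _).trans hm
            have h3 := Set.ncard_sdiff_add_ncard_of_subset (s := (D : Set G)) hDU
            rw [← hXD] at h3
            rw [Set.ncard_smul_set]
            omega
    · exact Or.inr ⟨hXrad, Or.inl (Subgroup.eq_top_of_card_eq _ (hm.trans hGcard.symm))⟩

end Paper
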